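/- Let m be an odd prime and let r, s be positive integers such that either s is even, or s is odd and r divides s·m. Then there exists a tight chiral rotation pair of type (2·r·m, s·m²). -/

import Mathlib

/-- A rotation pair of type `(p, q)`: the group is generated by `a` and `b`,
`a` has order `p`, `b` has order `q`, `p, q ≥ 2`, `(a*b)^2 = 1`, and the cyclic
subgroups generated by `a` and `b` intersect trivially. -/
def IsRotPair {G : Type*} [Group G] (a b : G) (p q : ℕ) : Prop :=
  Subgroup.closure ({a, b} : Set G) = ⊤ ∧ orderOf a = p ∧ orderOf b = q ∧
    2 ≤ p ∧ 2 ≤ q ∧ (a * b) ^ 2 = 1 ∧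
    Subgroup.zpowers a ⊓ Subgroup.zpowers b = ⊥

/-- Tightness: every element is `a ^ i * b ^ j` for some integers `i, j`. -/
def IsTight {G : Type*} [Group G] (a b : G) : Prop :=
  ∀ g : G, ∃ i j : ℤ, g = a ^ i * b ^ j

/-- Orientably regular: some group automorphism inverts both generators. -/
def IsOrientablyRegular {G : Type*} [Group G] (a b : G) : Prop :=
  ∃ φ : G ≃* G, φ a = a⁻¹ ∧ φ b = b⁻¹

/-- Chiral: no group automorphism inverts both generators. -/
def IsChiral {G : Type*} [Group G] (a b : G) : Prop :=
  ¬ IsOrientablyRegular a b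

/-- `(G, a, b)` covers `(H, a', b')` if a homomorphism sends `a ↦ a'`, `b ↦ b'`. -/
def Covers {G H : Type*} [Group G] [Group H] (a b : G) (a' b' : H) : Prop :=
  ∃ f : G →* H, f a = a' ∧ f b = b'

/-- An atomic chiral rotation pair of type `(p, q)`: a tight chiral rotation pair
covering no tight chiral rotation pair of type `(p', q)` with `p' < p` nor one of
type `(p, q')` with `q' < q`. -/
def IsAtomicPair {G : Type*} [Group G] (a b : G) (p q : ℕ) : Prop :=
  IsRotPair a b p q ∧ IsTight a b ∧ IsChiral a b ∧
  (∀ (H : Type) (instH : Group H) (_ : Finite H) (a' b' : H) (p' : ℕ), p' < p →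
      @IsRotPair H instH a' b' p' q → @IsTight H instH a' b' → @IsChiral H instH a' b' →
      ¬ @Covers G H _ instH a b a' b') ∧
  (∀ (H : Type) (instH : Group H) (_ : Finite H) (a' b' : H) (q' : ℕ), q' < q →
      @IsRotPair H instH a' b' p q' → @IsTight H instH a' b' → @IsChiral H instH a' b' →
      ¬ @Covers G H _ instH a b a' b')

/-- Data for a twisted extension of an abelian group by an involution. -/
structure TwDat (A : Type) [AddCommGroup A] where
  T : A →+ A
  TT : ∀ v, T (T v) = v
  B : A →+ A →+ A
  BB1 : ∀ u v w, B (B u v) w = 0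
  BB2 : ∀ u v w, B u (B v w) = 0
  alt : ∀ v, B v v = 0
  TB : ∀ u v, T (B u v) = B (T u) (T v)

/-- The twisted extension. -/
@[ext] structure TwExt {A : Type} [AddCommGroup A] (D : TwDat A) where
  v : A
  e : Bool

namespace TwExt
variable {A : Type} [AddCommGroup A] {D : TwDat A}

/-- The action of a sign. -/
def act (D : TwDat A) : Bool → A → A
  | false, v => v
  | true, v => D.T v

instance : Mul (TwExt D) := ⟨fun g h => ⟨g.v + act D g.e h.v + D.B g.v (act D g.e h.v), xor g.e h.e⟩⟩
instance : One (TwExt D) := ⟨⟨0, false⟩⟩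
instance : Inv (TwExt D) := ⟨fun g => ⟨- act D g.e g.v, g.e⟩⟩

theorem mul_def (g h : TwExt D) :
    g * h = ⟨g.v + act D g.e h.v + D.B g.v (act D g.e h.v), xor g.e h.e⟩ := rfl
theorem one_def : (1 : TwExt D) = ⟨0, false⟩ := rfl
theorem inv_def (g : TwExt D) : g⁻¹ = ⟨- act D g.e g.v, g.e⟩ := rfl

instance : Group (TwExt D) := Group.ofLeftAxioms
  (by
    rintro ⟨u, e⟩ ⟨v, f⟩ ⟨w, g⟩
    simp only [mul_def]
    cases e <;> cases f <;> simp [act, D.BB1, D.BB2, D.TB, D.TT] <;> abel)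
  (by
    rintro ⟨u, e⟩
    simp [mul_def, one_def, act])
  (by
    rintro ⟨u, e⟩
    cases e <;> simp [mul_def, one_def, inv_def, act, D.alt])

theorem mul_ff (u v : A) : (⟨u, false⟩ : TwExt D) * ⟨v, false⟩ = ⟨u + v + D.B u v, false⟩ := rfl
theorem inv_ff (u : A) : (⟨u, false⟩ : TwExt D)⁻¹ = ⟨-u, false⟩ := rfl

theorem pow_ff (u : A) (n : ℕ) : (⟨u, false⟩ : TwExt D) ^ n = ⟨n • u, false⟩ := by
  induction n with
  | zero => simp [one_def]
  | succ n ih => rw [pow_succ, ih, mul_ff]; simp [D.alt, add_smul]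

theorem zpow_ff (u : A) (n : ℤ) : (⟨u, false⟩ : TwExt D) ^ n = ⟨n • u, false⟩ := by
  cases n with
  | ofNat n => simp [pow_ff]
  | negSucc n => rw [zpow_negSucc, pow_ff, inv_ff, negSucc_zsmul]

/-- underlying equivalence -/
def equivProd (D : TwDat A) : TwExt D ≃ A × Bool where
  toFun g := (g.v, g.e)
  invFun p := ⟨p.1, p.2⟩
  left_inv _ := rfl
  right_inv _ := rfl

/-- the sign character -/
def sgn (D : TwDat A) : TwExt D →* ℤˣ where
  toFun g := cond g.e (-1) 1
  map_one' := rfl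
  map_mul' g h := by
    rcases g with ⟨u, e⟩
    rcases h with ⟨v, f⟩
    cases e <;> cases f <;> simp [mul_def]

/-- A character from an invariant additive character. -/
def chr (D : TwDat A) (f : A →+ ZMod 2) (hT : ∀ v, f (D.T v) = f v) (hB : ∀ u v, f (D.B u v) = 0) :
    TwExt D →* Multiplicative (ZMod 2) where
  toFun g := Multiplicative.ofAdd (f g.v)
  map_one' := by simp [one_def]
  map_mul' g h := by
    rcases g with ⟨u, e⟩
    rcases h with ⟨v, f⟩
    cases e <;> simp [mul_def, act, hT, hB]

end TwExt

/-- A word certifying chirality, whose mirror image has order dividing `m`. -/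
def ChCert {G : Type} [Group G] (a b : G) (m : ℕ) : Prop :=
  ∃ W : FreeGroup Bool, FreeGroup.lift (fun i => cond i a b) W = 1 ∧
    FreeGroup.lift (fun i => cond i a⁻¹ b⁻¹) W ≠ 1 ∧
    (FreeGroup.lift (fun i => cond i a⁻¹ b⁻¹) W) ^ m = 1

theorem chiral_of_word {G : Type} [Group G] {a b : G} (W : FreeGroup Bool)
    (h1 : FreeGroup.lift (fun i => cond i a b) W = 1)
    (h2 : FreeGroup.lift (fun i => cond i a⁻¹ b⁻¹) W ≠ 1) : IsChiral a b := by
  rintro ⟨φ, ha, hb⟩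
  apply h2
  have : φ.toMonoidHom.comp (FreeGroup.lift (fun i => cond i a b)) =
      FreeGroup.lift (fun i => cond i a⁻¹ b⁻¹) := by
    ext i
    cases i <;> simp [ha, hb]
  rw [← this]
  simp [h1]

theorem closure_of_tight {G : Type} [Group G] {a b : G} (h : IsTight a b) :
    Subgroup.closure ({a, b} : Set G) = ⊤ := by
  rw [eq_top_iff]
  rintro g -
  obtain ⟨i, j, rfl⟩ := h g
  exact mul_mem (zpow_mem (Subgroup.subset_closure (by simp)) _)
    (zpow_mem (Subgroup.subset_closure (by simp)) _)

theorem tight_of_card {G : Type} [Group G] [Finite G] {a b : G}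
    (hc : orderOf a * orderOf b = Nat.card G)
    (hd : Subgroup.zpowers a ⊓ Subgroup.zpowers b = ⊥) : IsTight a b := by
  have := Subgroup.isComplement'_of_card_mul_and_disjoint
    (H := Subgroup.zpowers a) (K := Subgroup.zpowers b)
    (by rw [Nat.card_zpowers, Nat.card_zpowers, hc]) (disjoint_iff.2 hd)
  intro g
  obtain ⟨⟨⟨x, i, hi⟩, ⟨y, j, hj⟩⟩, hxy⟩ := this.2 g
  refine ⟨i, j, ?_⟩
  simp only at hi hj hxy
  rw [← hxy, hi, hj]

theorem dual_pair {G : Type} [Group G] {a b : G} {p q : ℕ} (h : IsRotPair a b p q)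
    (ht : IsTight a b) (hc : IsChiral a b) :
    IsRotPair b a q p ∧ IsTight b a ∧ IsChiral b a := by
  obtain ⟨h1, h2, h3, h4, h5, h6, h7⟩ := h
  refine ⟨⟨by rwa [Set.pair_comm], h3, h2, h5, h4, ?_, by rwa [inf_comm]⟩, ?_, ?_⟩
  · have : (b * a) ^ 2 = b * (a * b) ^ 2 * b⁻¹ := by simp only [pow_two]; group
    rw [this, h6]; group
  · intro g
    obtain ⟨i, j, hg⟩ := ht g⁻¹
    refine ⟨-j, -i, ?_⟩
    rw [← inv_inv g, hg]; group
  · rintro ⟨φ, hb, ha⟩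
    exact hc ⟨φ, ha, hb⟩

theorem mix_pair {G : Type} [Group G] [Finite G] {a b : G} {m k n r : ℕ}
    (hrot : IsRotPair a b (2 * k) n) (ht : IsTight a b) (hcert : ChCert a b m)
    (hm : m.Prime) (hmodd : Odd m) (hn : Even n) (hr : 0 < r) (hmr : Nat.Coprime m r)
    (hkr : Nat.Coprime k r)
    (hpar : ∀ i i' j' : ℤ, b * a ^ i = a ^ i' * b ^ j' → Even (i' - i) ∧ Odd j') :
    ∃ (G : Type) (instG : Group G) (_ : Finite G) (a b : G),
      @IsRotPair G instG a b (2 * (k * r)) n ∧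
      @IsTight G instG a b ∧ @IsChiral G instG a b := by
  obtain ⟨h1, h2, h3, h4, h5, h6, h7⟩ := hrot
  have : NeZero (2 * r) := ⟨by omega⟩
  let c : DihedralGroup (2 * r) := DihedralGroup.r 1
  let d : DihedralGroup (2 * r) := DihedralGroup.sr 0
  have hcd : d * c * d⁻¹ = c⁻¹ := by simp [c, d]
  have hdd : d ^ 2 = 1 := by simp [d, pow_two]
  have hdo : orderOf d = 2 := DihedralGroup.orderOf_sr 0
  have hco : orderOf c = 2 * r := DihedralGroup.orderOf_r_one
  have hdci : ∀ i : ℤ, d * c ^ i = c ^ (-i) * d := by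
    intro i
    have : d * c ^ i * d⁻¹ = c ^ (-i) := by rw [← conj_zpow, hcd]; simp
    rw [← this]; group
  have hdodd : ∀ j : ℤ, Odd j → d ^ j = d := by
    rintro j ⟨l, rfl⟩
    rw [zpow_add, zpow_mul]
    have : d ^ (2 : ℤ) = 1 := by exact_mod_cast hdd
    simp [this]
  let P : G × DihedralGroup (2 * r) := (a, c)
  let Q : G × DihedralGroup (2 * r) := (b, d)
  let M := Subgroup.closure ({P, Q} : Set (G × DihedralGroup (2 * r)))
  have hP : P ∈ M := Subgroup.subset_closure (by simp)
  have hQ : Q ∈ M := Subgroup.subset_closure (by simp)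
  have hPi : ∀ i : ℤ, P ^ i = (a ^ i, c ^ i) := fun i => rfl
  have hQi : ∀ i : ℤ, Q ^ i = (b ^ i, d ^ i) := fun i => rfl
  -- the key commutation
  have key : ∀ i : ℤ, ∃ e f : ℤ, Q * P ^ i = P ^ e * Q ^ f := by
    intro i
    obtain ⟨i', j', hij⟩ := ht (b * a ^ i)
    obtain ⟨⟨l, hl⟩, hj⟩ := hpar i i' j' hij
    have hbz : (k : ℤ) * k.gcdA r + r * k.gcdB r = 1 := by
      have := Nat.gcd_eq_gcd_ab k r
      rw [hkr] at this
      exact_mod_cast this.symm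
    set x := k.gcdA r
    set y := k.gcdB r
    refine ⟨i' + (2 * k : ℕ) * (-(l + i) * x), j', ?_⟩
    rw [hPi, hPi, hQi]
    simp only [Q, Prod.mk_mul_mk]
    congr 1
    · rw [hij, zpow_add, zpow_mul, zpow_natCast, ← h2, pow_orderOf_eq_one]; simp
    · rw [hdci, hdodd _ hj]
      congr 1
      have : i' + ((2 * k : ℕ) : ℤ) * (-(l + i) * x) = -i + (2 * r : ℕ) * ((l + i) * y) := by
        push_cast
        linear_combination hl - 2 * (l + i) * hbz
      have hc1 : c ^ (2 * r) = 1 := orderOf_dvd_iff_pow_eq_one.1 (dvd_of_eq hco)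
      rw [this, zpow_add, zpow_mul, zpow_natCast, hc1]; simp
  have keyall : ∀ g ∈ M, ∃ i j : ℤ, g = P ^ i * Q ^ j := by
    have hfin : ∀ (g : G × DihedralGroup (2 * r)), g ∈ Submonoid.closure ({P, Q} : Set _) →
        ∃ i j : ℤ, g = P ^ i * Q ^ j := by
      intro g hg
      induction hg using Submonoid.closure_induction_left with
      | one => exact ⟨0, 0, by simp⟩
      | mul_left x hx y hy ih =>
        obtain ⟨i, j, rfl⟩ := ih
        rcases hx with rfl | rfl
        · exact ⟨i + 1, j, by rw [zpow_add_one, ← mul_assoc, ← zpow_one_add, add_comm, zpow_add_one]⟩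
        · obtain ⟨e, f, hef⟩ := key i
          exact ⟨e, f + j, by rw [← mul_assoc, hef, mul_assoc, zpow_add]⟩
    intro g hg
    apply hfin
    rwa [← Subgroup.closure_toSubmonoid_of_finite]
  have htM : IsTight (⟨P, hP⟩ : M) ⟨Q, hQ⟩ := by
    rintro ⟨g, hg⟩
    obtain ⟨i, j, hij⟩ := keyall g hg
    exact ⟨i, j, Subtype.ext hij⟩
  refine ⟨M, inferInstance, inferInstance, ⟨P, hP⟩, ⟨Q, hQ⟩,
    ⟨closure_of_tight htM, ?_, ?_, ?_, h5, ?_, ?_⟩, htM, ?_⟩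
  · rw [Subgroup.orderOf_mk, Prod.orderOf_mk, h2, hco, Nat.lcm_mul_left, hkr.lcm_eq_mul]
  · rw [Subgroup.orderOf_mk, Prod.orderOf_mk, h3, hdo]
    exact Nat.lcm_eq_left hn.two_dvd
  · nlinarith
  · apply Subtype.ext
    change (P * Q) ^ 2 = 1
    have : (c * d) ^ 2 = 1 := by simp [c, d, pow_two]
    simp only [P, Q, Prod.mk_mul_mk, Prod.pow_mk, h6, this]; rfl
  · rw [eq_bot_iff]
    rintro ⟨g, hg⟩ ⟨⟨i, hi⟩, ⟨j, hj⟩⟩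
    have hi' : P ^ i = g := congrArg Subtype.val hi
    have hj' : Q ^ j = g := congrArg Subtype.val hj
    rw [hPi] at hi'
    rw [hQi] at hj'
    have hg1 : g.1 = 1 := by
      have : g.1 ∈ Subgroup.zpowers a ⊓ Subgroup.zpowers b :=
        ⟨⟨i, congrArg Prod.fst hi'⟩, ⟨j, congrArg Prod.fst hj'⟩⟩
      rw [h7] at this
      simpa using this
    have hje : (2 : ℤ) ∣ j := by
      have : b ^ j = 1 := by rw [← hg1]; exact congrArg Prod.fst hj'
      have := orderOf_dvd_iff_zpow_eq_one.2 this
      rw [h3] at this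
      exact dvd_trans (by exact_mod_cast hn.two_dvd) this
    have hg2 : g.2 = 1 := by
      rw [← hj']
      change d ^ j = 1
      rw [← orderOf_dvd_iff_zpow_eq_one, hdo]
      exact_mod_cast hje
    have : g = 1 := Prod.ext hg1 hg2
    simp [this]
  · -- chirality
    obtain ⟨W, w1, w2, w3⟩ := hcert
    have hM : ∀ (p q : M) (V : FreeGroup Bool),
        ((FreeGroup.lift (fun i => cond i p q) V : M) : G × DihedralGroup (2 * r)) =
        (FreeGroup.lift (fun i => cond i p.1.1 q.1.1) V, FreeGroup.lift (fun i => cond i p.1.2 q.1.2) V) := by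
      intro p q V
      have : M.subtype.comp (FreeGroup.lift (fun i => cond i p q)) =
          (FreeGroup.lift (fun i => cond i p.1.1 q.1.1)).prod
            (FreeGroup.lift (fun i => cond i p.1.2 q.1.2)) := by
        ext i <;> cases i <;> simp
      exact DFunLike.congr_fun this V
    have hK : ∀ x : DihedralGroup (2 * r), x ^ (4 * r) = 1 := by
      intro x
      have : Nat.card (DihedralGroup (2 * r)) = 4 * r := by
        rw [DihedralGroup.nat_card]; ring
      rw [← this, pow_card_eq_one']
    refine chiral_of_word (W ^ (4 * r)) ?_ ?_
    · apply Subtype.ext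
      rw [hM, map_pow, map_pow, hK]
      simp only [P, Q, w1, one_pow]
      rfl
    · intro h
      have h' := congrArg Prod.fst ((hM _ _ _).symm.trans (congrArg Subtype.val h))
      simp only [map_pow] at h'
      change (FreeGroup.lift (fun i => cond i a⁻¹ b⁻¹) W) ^ (4 * r) = 1 at h'
      apply w2
      rw [← orderOf_eq_one_iff]
      apply Nat.eq_one_of_dvd_coprimes (k := orderOf _) _ (orderOf_dvd_of_pow_eq_one w3)
        (orderOf_dvd_of_pow_eq_one h')
      apply Nat.Coprime.mul_right _ hmr
      have : Nat.Coprime m (2 ^ 2) := Nat.Coprime.pow_right _ hmodd.coprime_two_right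
      exact this

section base
variable (m r s : ℕ)

/-- the central vector -/
def bw : ZMod (s * m ^ 2) × ZMod (r * m) := (((2 * (s * m) : ℕ) : ZMod _), -((s * m : ℕ) : ZMod _))

variable {m r s}

theorem bw_smul (h : r ∣ s * m) : (m : ℤ) • bw m r s = 0 := by
  ext
  · rw [Prod.smul_fst, zsmul_eq_mul, Prod.fst_zero]
    simp only [bw]
    rw [Int.cast_natCast, ← Nat.cast_mul, ZMod.natCast_eq_zero_iff]
    exact ⟨2, by ring⟩
  · rw [Prod.smul_snd, zsmul_eq_mul, Prod.snd_zero]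
    simp only [bw, mul_neg, neg_eq_zero]
    rw [Int.cast_natCast, ← Nat.cast_mul, ZMod.natCast_eq_zero_iff, mul_comm m]
    exact Nat.mul_dvd_mul_right h m

/-- multiples of the central vector -/
def bmu (h : r ∣ s * m) : ZMod m →+ ZMod (s * m ^ 2) × ZMod (r * m) :=
  ZMod.lift m ⟨zmultiplesHom _ (bw m r s), by simpa using bw_smul h⟩

theorem bmu_int (h : r ∣ s * m) (z : ℤ) : bmu h (z : ZMod m) = z • bw m r s := by
  simp [bmu]

/-- first reduction -/
def pr1 : ZMod (s * m ^ 2) →+* ZMod m := ZMod.castHom ⟨s * m, by ring⟩ _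
/-- second reduction -/
def pr2 : ZMod (r * m) →+* ZMod m := ZMod.castHom ⟨r, by ring⟩ _
/-- third reduction -/
def pr3 (h : r ∣ s * m) : ZMod (s * m ^ 2) →+* ZMod (r * m) :=
  ZMod.castHom (by rw [pow_two, ← mul_assoc]; exact Nat.mul_dvd_mul_right h m) _

theorem pr1_bmu (h : r ∣ s * m) (c : ZMod m) : pr1 (bmu h c).1 = 0 := by
  obtain ⟨z, rfl⟩ := ZMod.intCast_surjective c
  simp [bmu_int, bw]

theorem pr2_bmu (h : r ∣ s * m) (c : ZMod m) : pr2 (bmu h c).2 = 0 := by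
  obtain ⟨z, rfl⟩ := ZMod.intCast_surjective c
  simp [bmu_int, bw]

theorem pr2_pr3 (h : r ∣ s * m) (c : ZMod (s * m ^ 2)) : pr2 (pr3 h c) = pr1 c := by
  obtain ⟨z, rfl⟩ := ZMod.intCast_surjective c
  simp

/-- the swap -/
def bT (h : r ∣ s * m) : ZMod (s * m ^ 2) × ZMod (r * m) →+ ZMod (s * m ^ 2) × ZMod (r * m) :=
  AddMonoidHom.mk' (fun v => (-v.1, pr3 h v.1 + v.2)) (by
    intro u v
    ext <;> simp <;> ring)

theorem bT_apply (h : r ∣ s * m) (v : ZMod (s * m ^ 2) × ZMod (r * m)) :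
    bT h v = (-v.1, pr3 h v.1 + v.2) := rfl

theorem bT_bmu (h : r ∣ s * m) (c : ZMod m) : bT h (bmu h c) = bmu h (-c) := by
  obtain ⟨z, rfl⟩ := ZMod.intCast_surjective c
  rw [map_neg, bmu_int, map_zsmul, ← smul_neg]
  congr 1
  ext
  · simp [bT_apply, bw]
  · simp only [bT_apply, bw, map_natCast, Prod.snd_neg]; push_cast; ring

/-- the bilinear map -/
def bB (h : r ∣ s * m) : ZMod (s * m ^ 2) × ZMod (r * m) →+
    ZMod (s * m ^ 2) × ZMod (r * m) →+ ZMod (s * m ^ 2) × ZMod (r * m) :=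
  AddMonoidHom.mk' (fun u => AddMonoidHom.mk'
    (fun v => bmu h (pr1 u.1 * pr2 v.2 - pr2 u.2 * pr1 v.1)) (by
      intro v w
      rw [← map_add]; congr 1; simp; ring)) (by
    intro u v
    ext1 w
    simp only [AddMonoidHom.mk'_apply, AddMonoidHom.add_apply]
    rw [← map_add]; congr 1; simp; ring)

theorem bB_apply (h : r ∣ s * m) (u v : ZMod (s * m ^ 2) × ZMod (r * m)) :
    bB h u v = bmu h (pr1 u.1 * pr2 v.2 - pr2 u.2 * pr1 v.1) := rfl

/-- the data -/
def bD (h : r ∣ s * m) : TwDat (ZMod (s * m ^ 2) × ZMod (r * m)) where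
  T := bT h
  TT v := by simp [bT_apply]
  B := bB h
  BB1 u v w := by rw [bB_apply, bB_apply, pr1_bmu, pr2_bmu]; simp
  BB2 u v w := by rw [bB_apply, bB_apply _ v w, pr1_bmu, pr2_bmu]; simp
  alt v := by rw [bB_apply, mul_comm (pr1 v.1), sub_self, map_zero]
  TB u v := by
    rw [bB_apply, bB_apply, bT_bmu]; congr 1
    simp [bT_apply, pr2_pr3]; ring

end base

theorem base_pair {m r s : ℕ} (hm : m.Prime) (hmodd : Odd m) (hr : 0 < r) (hs : 0 < s)
    (h : r ∣ s * m) :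
    ∃ (G : Type) (_ : Group G) (_ : Finite G) (a b : G),
      IsRotPair a b (2 * (r * m)) (s * m ^ 2) ∧ IsTight a b ∧ ChCert a b m ∧
      (Even s → ∀ i i' j' : ℤ, b * a ^ i = a ^ i' * b ^ j' → Even (i' - i) ∧ Odd j') := by
  have hm0 := hm.pos
  have hm2 := hm.two_le
  have : NeZero (s * m ^ 2) := ⟨by positivity⟩
  have : NeZero (r * m) := ⟨by positivity⟩
  have hBx : ∀ u v, (bD h).B u v = bmu h (pr1 u.1 * pr2 v.2 - pr2 u.2 * pr1 v.1) := fun _ _ => rfl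
  have hTx : ∀ v, (bD h).T v = (-v.1, pr3 h v.1 + v.2) := fun _ => rfl
  have hmu1 : bmu h 1 = bw m r s := by simpa using bmu_int h 1
  have hmw : m • bw m r s = 0 := by simpa using bw_smul h
  let x : ZMod (s * m ^ 2) × ZMod (r * m) := (1, 0)
  let y : ZMod (s * m ^ 2) × ZMod (r * m) := (-1, 1)
  let w := bw m r s
  have hTX : (bD h).T x = y := by simp [hTx, x, y]
  have hTY : (bD h).T y = x := by simp [hTx, x, y]
  have hxy : (bD h).B x y = w := by simp [hBx, x, y, hmu1, w]
  have hyx : (bD h).B y x = -w := by simp [hBx, x, y, hmu1, w]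
  have hxw : (bD h).B x w = 0 := by rw [← hxy, (bD h).BB2]
  have hyw : (bD h).B y w = 0 := by rw [← hxy, (bD h).BB2]
  have hwx : (bD h).B w x = 0 := by rw [← hxy, (bD h).BB1]
  have hwy : (bD h).B w y = 0 := by rw [← hxy, (bD h).BB1]
  have hww : (bD h).B w w = 0 := (bD h).alt _
  have hxx : (bD h).B x x = 0 := (bD h).alt _
  have hyy : (bD h).B y y = 0 := (bD h).alt _
  have hmw' : m • w = 0 := hmw
  have hsw : (s * m) • w = 0 := by rw [mul_smul, hmw', smul_zero]
  have hsxy : (s * m) • (x - y) = w := by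
    ext
    · simp [x, y, w, bw]; ring
    · simp [x, y, w, bw]
  let b : TwExt (bD h) := ⟨x, false⟩
  let t : TwExt (bD h) := ⟨0, true⟩
  let a : TwExt (bD h) := ⟨-y, true⟩
  have hat : a * b = t := by
    simp [a, b, t, TwExt.mul_def, TwExt.act, hTX, hyy]
  have htt : t * t = 1 := by simp [t, TwExt.mul_def, TwExt.act, TwExt.one_def]
  let c := x + y + w
  have ha2 : a ^ 2 = ⟨-c, false⟩ := by
    simp [a, c, pow_two, TwExt.mul_def, TwExt.act, hTY, hyx]; abel
  have hae : ∀ i : ℤ, a ^ (2 * i) = ⟨i • -c, false⟩ := by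
    intro i
    rw [zpow_mul, ← TwExt.zpow_ff, ← ha2]; rfl
  have hsa : TwExt.sgn (bD h) a = -1 := rfl
  have hsb : TwExt.sgn (bD h) b = 1 := rfl
  -- second coordinate of c is a unit
  have hunit : IsCoprime (1 - (s * m : ℤ)) ((r * m : ℕ) : ℤ) := by
    have h1 : IsCoprime (1 - (s * m : ℤ)) (s * m) := ⟨1, 1, by ring⟩
    push_cast
    refine IsCoprime.mul_right ?_ ?_
    · exact h1.of_isCoprime_of_dvd_right (by exact_mod_cast h)
    · exact h1.of_isCoprime_of_dvd_right ⟨s, by ring⟩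
  have hc2 : ∀ i : ℤ, (i • -c).2 = 0 → ((r * m : ℕ) : ℤ) ∣ i := by
    intro i hi
    have : ((i * (1 - (s * m : ℤ)) : ℤ) : ZMod (r * m)) = 0 := by
      rw [← neg_eq_zero, ← hi]
      simp [c, x, y, w, bw]; ring
    rw [ZMod.intCast_zmod_eq_zero_iff_dvd] at this
    exact hunit.symm.dvd_of_dvd_mul_right this
  have hca : ∀ i : ℤ, ((r * m : ℕ) : ℤ) ∣ i → i • -c = 0 := by
    rintro i ⟨l, rfl⟩
    have : ((r * m : ℕ) : ℤ) • c = 0 := by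
      have hw0 : (r * m) • w = 0 := by rw [mul_smul, hmw', smul_zero]
      rw [natCast_zsmul]
      simp only [c, smul_add, hw0, add_zero]
      rw [← smul_add]
      ext
      · simp [x, y]
      · have : ((r * m : ℕ) : ZMod (r * m)) = 0 := ZMod.natCast_self _
        simpa [x, y] using this
    rw [mul_comm _ l, mul_smul, smul_neg, this]; simp
  have heven : ∀ i : ℤ, (a ^ i).e = false → ∃ l, i = 2 * l := by
    intro i hi
    have h1 : TwExt.sgn (bD h) (a ^ i) = 1 := by
      change cond (a ^ i).e (-1 : ℤˣ) 1 = 1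
      rw [hi]; rfl
    rw [map_zpow, hsa] at h1
    have := (Int.negOnePow_eq_one_iff i).1 h1
    exact (even_iff_two_dvd.1 this)
  have hbe : ∀ j : ℤ, b ^ j = ⟨j • x, false⟩ := fun j => TwExt.zpow_ff x j
  have hoa : orderOf a = 2 * (r * m) := by
    apply Nat.dvd_antisymm
    · rw [orderOf_dvd_iff_pow_eq_one, ← zpow_natCast]
      have := hae (r * m : ℕ)
      push_cast at this ⊢
      rw [this, hca _ (by simp)]; rfl
    · have h1 := pow_orderOf_eq_one a
      rw [← zpow_natCast] at h1
      obtain ⟨l, hl⟩ := heven _ (by rw [h1]; rfl)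
      rw [hl, hae] at h1
      have := hc2 l (congrArg (fun g => g.v.2) h1)
      zify
      rw [hl]
      exact mul_dvd_mul_left 2 (by exact_mod_cast this)
  have hob : orderOf b = s * m ^ 2 := by
    apply Nat.dvd_antisymm
    · rw [orderOf_dvd_iff_pow_eq_one, TwExt.pow_ff]
      have : ((s * m ^ 2 : ℕ) : ZMod (s * m ^ 2)) = 0 := ZMod.natCast_self _
      ext
      · simpa [x, TwExt.one_def] using this
      · simp [x, TwExt.one_def]
      · rfl
    · have h1 := pow_orderOf_eq_one b
      rw [TwExt.pow_ff] at h1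
      have := congrArg (fun g => g.v.1) h1
      rw [← ZMod.natCast_eq_zero_iff]
      simpa [x, TwExt.one_def] using this
  have hdis : Subgroup.zpowers a ⊓ Subgroup.zpowers b = ⊥ := by
    rw [eq_bot_iff]
    rintro g ⟨⟨i, hi⟩, ⟨j, hj⟩⟩
    simp only at hi hj
    rw [hbe] at hj
    obtain ⟨l, rfl⟩ := heven i (by rw [hi, ← hj])
    rw [hae] at hi
    have h2 : (l • -c).2 = 0 := by
      rw [← hj] at hi
      have h3 : (l • -c).2 = (j • x).2 := congrArg (fun g => g.v.2) hi
      rw [h3]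
      simp [x]
    rw [Subgroup.mem_bot, ← hi, hca _ (hc2 _ h2)]; rfl
  have : Finite (TwExt (bD h)) := Finite.of_equiv _ (TwExt.equivProd (bD h)).symm
  have hcard : Nat.card (TwExt (bD h)) = (s * m ^ 2) * (r * m) * 2 := by
    rw [Nat.card_congr (TwExt.equivProd (bD h)), Nat.card_prod, Nat.card_prod]
    simp
  have htight : IsTight a b := tight_of_card (by rw [hoa, hob, hcard]; ring) hdis
  refine ⟨TwExt (bD h), inferInstance, this, a, b,
    ⟨closure_of_tight htight, hoa, hob, ?_, ?_, ?_, hdis⟩, htight, ?_, ?_⟩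
  · have := Nat.mul_pos hr hm0; omega
  · nlinarith
  · rw [hat, pow_two t, htt]
  · let α : FreeGroup Bool := FreeGroup.of true
    let β : FreeGroup Bool := FreeGroup.of false
    let Y := (α * β) * β * (α * β)⁻¹
    refine ⟨(β * Y * β⁻¹ * Y⁻¹) * ((β * Y⁻¹) ^ (s * m))⁻¹ * ((β * Y⁻¹) ^ (s * m))⁻¹, ?_, ?_⟩
    · have hY : (a * b) * b * (a * b)⁻¹ = ⟨y, false⟩ := by
        rw [hat]
        simp [t, b, TwExt.mul_def, TwExt.inv_def, TwExt.act, hTX]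
      simp only [α, β, Y, map_mul, map_inv, map_pow, FreeGroup.lift_apply_of, cond_true, cond_false]
      rw [hY]
      simp only [b, TwExt.inv_ff, TwExt.mul_ff, TwExt.pow_ff]
      have hp : (s * m) • (x + -y + (bD h).B x (-y)) = w := by
        rw [smul_add, ← sub_eq_add_neg, hsxy, map_neg, hxy, smul_neg, hsw]; simp
      rw [hp]
      simp [hxy, hyx, hxx, hyy, hxw, hyw, hwx, hwy, hww, TwExt.one_def]
      try abel
    · have hY : (a⁻¹ * b⁻¹) * b⁻¹ * (a⁻¹ * b⁻¹)⁻¹ = ⟨-y - w - w, false⟩ := by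
        have e1 : a⁻¹ * b⁻¹ = b * t * b⁻¹ := by
          rw [← inv_eq_of_mul_eq_one_left htt, ← hat]; group
        have e2 : t * b⁻¹ * t⁻¹ = ⟨-y, false⟩ := by
          simp [t, b, TwExt.mul_def, TwExt.inv_def, TwExt.act, hTX]
        have e3 : (a⁻¹ * b⁻¹) * b⁻¹ * (a⁻¹ * b⁻¹)⁻¹ = b * (t * b⁻¹ * t⁻¹) * b⁻¹ := by
          rw [e1]; group
        rw [e3, e2]
        simp only [b, TwExt.inv_ff, TwExt.mul_ff]
        congr 1
        simp [hxy, hyx, hxx, hwx]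
        abel
      simp only [α, β, Y, map_mul, map_inv, map_pow, FreeGroup.lift_apply_of, cond_true, cond_false]
      rw [hY]
      have hp : (s * m) • (-x + -(-y - w - w) + (bD h).B (-x) (-(-y - w - w))) = -w := by
        have : -x + -(-y - w - w) + (bD h).B (-x) (-(-y - w - w)) = -(x - y) + w := by
          simp [hxy, hxw]; abel
        rw [this, smul_add, smul_neg, hsxy, hsw]; simp
      have hfin : ∀ V : TwExt (bD h), V = ⟨4 • w, false⟩ → V ≠ 1 ∧ V ^ m = 1 := by
        rintro V rfl
        constructor
        · intro h1
          have := congrArg (fun g => g.v.1) h1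
          simp only [TwExt.one_def, w, bw, Prod.smul_fst, Prod.fst_zero] at this
          rw [nsmul_eq_mul, ← Nat.cast_mul, ZMod.natCast_eq_zero_iff] at this
          have h8 : (s * m) * m ∣ (s * m) * 2 ^ 3 := by
            convert this using 1 <;> ring
          have h8 := Nat.dvd_of_mul_dvd_mul_left (by positivity) h8
          have := hm.dvd_of_dvd_pow h8
          have := (Nat.prime_dvd_prime_iff_eq hm Nat.prime_two).1 this
          subst this
          exact absurd hmodd (by decide)
        · rw [TwExt.pow_ff, smul_comm, hmw']; simp [TwExt.one_def]
      refine hfin _ ?_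
      simp only [b, TwExt.inv_ff, TwExt.mul_ff, TwExt.pow_ff]
      rw [hp]
      congr 1
      have h4 : 4 • w = w + w + w + w := by abel
      rw [h4]
      simp [hxy, hyx, hxx, hyy, hxw, hyw, hwx, hwy, hww]
      abel
  · intro hse i i' j' hij
    have hd : 2 ∣ s * m ^ 2 := Dvd.dvd.mul_right hse.two_dvd _
    have hi : Even (i' - i) := by
      have := congrArg (TwExt.sgn (bD h)) hij
      simp only [map_mul, map_zpow, hsa, hsb, one_mul, one_zpow, mul_one] at this
      exact (Int.negOnePow_eq_iff i' i).1 this.symm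
    refine ⟨hi, ?_⟩
    let f : ZMod (s * m ^ 2) × ZMod (r * m) →+ ZMod 2 :=
      (ZMod.castHom hd (ZMod 2)).toAddMonoidHom.comp (AddMonoidHom.fst _ _)
    have hf : ∀ v, f v = ZMod.castHom hd (ZMod 2) v.1 := fun _ => rfl
    have h20 : (2 : ZMod 2) = 0 := rfl
    let χ := TwExt.chr (bD h) f (by
      intro v
      rw [hTx, hf, hf]
      simp only [map_neg]
      exact ZMod.neg_eq_self_mod_two _) (by
      intro u v
      rw [hBx, hf]
      obtain ⟨z, hz⟩ := ZMod.intCast_surjective (pr1 u.1 * pr2 v.2 - pr2 u.2 * pr1 v.1 : ZMod m)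
      rw [← hz, bmu_int]
      simp only [bw, Prod.smul_fst, map_zsmul, map_natCast]
      simp [h20])
    have hχa : χ a = Multiplicative.ofAdd 1 := by
      change Multiplicative.ofAdd (f (-y)) = _
      rw [hf]; simp only [y, Prod.neg_mk, neg_neg, map_one]
    have hχb : χ b = Multiplicative.ofAdd 1 := by
      change Multiplicative.ofAdd (f x) = _
      rw [hf]; simp only [x, map_one]
    have h1 := congrArg χ hij
    simp only [map_mul, map_zpow, hχa, hχb, ← ofAdd_zsmul, ← ofAdd_add] at h1
    have h2 := Multiplicative.ofAdd.injective h1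
    have h3 : ((i' + j' - (1 + i) : ℤ) : ZMod 2) = 0 := by
      push_cast
      simp only [zsmul_eq_mul, mul_one] at h2
      rw [h2]; ring
    rw [ZMod.intCast_zmod_eq_zero_iff_dvd] at h3
    obtain ⟨p, hp⟩ := h3
    obtain ⟨q, hq⟩ := hi
    push_cast at hp
    exact ⟨p - q, by omega⟩

theorem even_pair {m r s α r2 : ℕ} (hm : m.Prime) (hmodd : Odd m) (hs : 0 < s) (hse : Even s)
    (hr : r = m ^ α * r2) (hr2 : 0 < r2) (hmr : ¬ m ∣ r2) (hd : m ^ α ∣ s * m) :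
    ∃ (G : Type) (instG : Group G) (_ : Finite G) (a b : G),
      @IsRotPair G instG a b (2 * r * m) (s * m ^ 2) ∧
      @IsTight G instG a b ∧ @IsChiral G instG a b := by
  obtain ⟨G, _, _, a, b, h1, h2, h3, h4⟩ :=
    base_pair hm hmodd (pow_pos hm.pos α) hs hd
  have hc : Nat.Coprime m r2 := (Nat.Prime.coprime_iff_not_dvd hm).2 hmr
  have := mix_pair h1 h2 h3 hm hmodd (hse.mul_right _) hr2 hc
    (Nat.Coprime.mul_left (Nat.Coprime.pow_left _ hc) hc) (h4 hse)
  have e : 2 * r * m = 2 * (m ^ α * m * r2) := by rw [hr]; ring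
  rw [e]
  exact this

/-- For `m` an odd prime and positive integers `r, s` with `s` even, or `s` odd and
`r ∣ sm`, there is a tight chiral rotation pair of type `(2rm, sm²)`. -/
theorem exists_tight_chiral_odd_family (m r s : ℕ) (hm : m.Prime) (hmodd : Odd m)
    (hr : 0 < r) (hs : 0 < s) (h : Even s ∨ (Odd s ∧ r ∣ s * m)) :
    ∃ (G : Type) (instG : Group G) (_ : Finite G) (a b : G),
      @IsRotPair G instG a b (2 * r * m) (s * m ^ 2) ∧
      @IsTight G instG a b ∧ @IsChiral G instG a b := by
  by_cases hse : Even s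
  · obtain ⟨α, r2, hmr, hrr⟩ := Nat.exists_eq_pow_mul_and_not_dvd hr.ne' m hm.ne_one
    have hr2 : 0 < r2 := Nat.pos_of_ne_zero (by rintro rfl; simp at hmr)
    by_cases hd : m ^ α ∣ s * m
    · exact even_pair hm hmodd hs hse hrr hr2 hmr hd
    · obtain ⟨β, s2, hms, hss⟩ := Nat.exists_eq_pow_mul_and_not_dvd hs.ne' m hm.ne_one
      have hs20 : 0 < s2 := Nat.pos_of_ne_zero (by rintro rfl; simp at hms)
      have hlt : β + 1 < α := by
        by_contra hle
        exact hd ((pow_dvd_pow m (not_lt.1 hle)).trans ⟨s2, by rw [hss]; ring⟩)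
      obtain ⟨γ, rfl⟩ : ∃ γ, α = γ + 1 := ⟨α - 1, by omega⟩
      obtain ⟨s3, hs3⟩ : 2 ∣ s2 := by
        have := hse.two_dvd
        rw [hss] at this
        exact (Nat.Coprime.dvd_of_dvd_mul_left
          ((hmodd.pow).coprime_two_left) this)
      have key := even_pair (m := m) (r := m ^ (β + 1) * s3) (s := 2 * (m ^ γ * r2)) (α := β + 1)
        (r2 := s3) hm hmodd (by have := hm.pos; positivity) (even_two_mul _) rfl (by omega)
        (fun hd => hms (hs3 ▸ Dvd.dvd.mul_left hd 2))
        ((pow_dvd_pow m hlt.le).trans ⟨2 * r2, by ring⟩)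
      obtain ⟨G, i1, i2, a, b, h1, h2, h3⟩ := key
      have e1 : 2 * (m ^ (β + 1) * s3) * m = s * m ^ 2 := by rw [hss, hs3]; ring
      have e2 : 2 * (m ^ γ * r2) * m ^ 2 = 2 * r * m := by rw [hrr]; ring
      rw [e1, e2] at h1
      exact ⟨G, i1, i2, b, a, dual_pair h1 h2 h3⟩
  · have hd : r ∣ s * m := by tauto
    obtain ⟨G, i1, i2, a, b, h1, h2, h3, -⟩ := base_pair hm hmodd hr hs hd
    obtain ⟨W, w1, w2, -⟩ := h3
    exact ⟨G, i1, i2, a, b, by rwa [mul_assoc], h2, chiral_of_word W w1 w2⟩
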